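/- Let ε ∈ (0,1), let 𝒮 ⊆ 𝒟 be an ε-sparse family, and let Q* ∈ 𝒮. Then for every integer j ≥ 0, the Lebesgue measure of the set {x ∈ Q* : the number of intervals ℓ ∈ 𝒮 with ℓ ⊆ Q* and x ∈ ℓ is at least j + 1} is at most ε^j |Q*|; in particular the measure of the set where at least j+1 intervals of 𝒮 inside Q* overlap decays exponentially in j. -/

import Mathlib

open MeasureTheory

noncomputable section

/-- The dyadic interval `[k/2^n, (k+1)/2^n)`. -/
def dyadicI (n k : ℕ) : Set ℝ := Set.Ico ((k : ℝ) / 2 ^ n) (((k : ℝ) + 1) / 2 ^ n)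

/-- The length of a dyadic interval of generation `n`. -/
def dyadicLen (n : ℕ) : ℝ := 1 / 2 ^ n

/-- A family `𝒮` of dyadic intervals of `[0,1)` (encoded by pairs `(n,k)`, `k < 2^n`) is
`ε`-sparse: for every `J ∈ 𝒮`, `Σ_{I ∈ 𝒮, I ⊊ J} |I| ≤ ε |J|` (expressed through all finite
subfamilies). -/
def IsSparse (ε : ℝ) (𝒮 : Set (ℕ × ℕ)) : Prop :=
  (∀ p ∈ 𝒮, p.2 < 2 ^ p.1) ∧
  ∀ p ∈ 𝒮, ∀ F : Finset (ℕ × ℕ),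
    (∀ q ∈ F, q ∈ 𝒮 ∧ dyadicI q.1 q.2 ⊂ dyadicI p.1 p.2) →
    ∑ q ∈ F, dyadicLen q.1 ≤ ε * dyadicLen p.1

theorem mem_dyadicI_iff {n k : ℕ} {x : ℝ} :
    x ∈ dyadicI n k ↔ (k : ℝ) ≤ x * 2 ^ n ∧ x * 2 ^ n < (k : ℝ) + 1 := by
  have h : (0 : ℝ) < 2 ^ n := by positivity
  rw [dyadicI, Set.mem_Ico, div_le_iff₀ h, lt_div_iff₀ h]

theorem dyadicI_subset_of_mem {m k m' k' : ℕ} {x : ℝ} (hm : m ≤ m')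
    (hx : x ∈ dyadicI m k) (hx' : x ∈ dyadicI m' k') : dyadicI m' k' ⊆ dyadicI m k := by
  obtain ⟨d, rfl⟩ := Nat.exists_eq_add_of_le hm
  have hd : (0 : ℝ) < 2 ^ d := by positivity
  simp only [mem_dyadicI_iff, pow_add, ← mul_assoc] at hx hx'
  have h₁ : k * 2 ^ d < k' + 1 := by
    have : (k : ℝ) * 2 ^ d < k' + 1 :=
      (mul_le_mul_of_nonneg_right hx.1 hd.le).trans_lt hx'.2
    exact_mod_cast this
  have h₂ : k' < (k + 1) * 2 ^ d := by
    have : (k' : ℝ) < (k + 1) * 2 ^ d :=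
      hx'.1.trans_lt (mul_lt_mul_of_pos_right hx.2 hd)
    exact_mod_cast this
  have h₁' : (k : ℝ) * 2 ^ d ≤ k' := by exact_mod_cast Nat.lt_succ_iff.mp h₁
  have h₂' : (k' : ℝ) + 1 ≤ (k + 1) * 2 ^ d := by exact_mod_cast h₂
  intro y hy
  simp only [mem_dyadicI_iff, pow_add, ← mul_assoc] at hy ⊢
  exact ⟨le_of_mul_le_mul_right (h₁'.trans hy.1) hd,
    lt_of_mul_lt_mul_right (hy.2.trans_le h₂') hd.le⟩

theorem dyadicLen_nonneg (n : ℕ) : 0 ≤ dyadicLen n := by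
  unfold dyadicLen
  positivity

theorem volume_dyadicI (n k : ℕ) :
    volume (dyadicI n k) = ENNReal.ofReal (dyadicLen n) := by
  rw [dyadicI, Real.volume_Ico, dyadicLen]
  congr 1
  ring

theorem dyadicI_injective {p q : ℕ × ℕ} (h : dyadicI p.1 p.2 = dyadicI q.1 q.2) : p = q := by
  obtain ⟨n, k⟩ := p
  obtain ⟨m, l⟩ := q
  simp only at h
  have hv : dyadicLen n = dyadicLen m := by
    have := congrArg volume h
    rwa [volume_dyadicI, volume_dyadicI,
      ENNReal.ofReal_eq_ofReal_iff (dyadicLen_nonneg _) (dyadicLen_nonneg _)] at this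
  have hnm : n = m := by
    simp only [dyadicLen, one_div, inv_inj] at hv
    exact pow_right_injective₀ (by norm_num) (by norm_num) hv
  subst hnm
  have hx : (k : ℝ) / 2 ^ n ∈ dyadicI n k := by simp [mem_dyadicI_iff]
  have hx' := h ▸ hx
  rw [mem_dyadicI_iff, div_mul_cancel₀ _ (by positivity)] at hx'
  have h₁ : l ≤ k := by exact_mod_cast hx'.1
  have h₂ : k < l + 1 := by exact_mod_cast hx'.2
  rw [Prod.mk.injEq]
  exact ⟨rfl, by omega⟩

/-- The intervals of `𝒮` inside the interval `p` that contain `x`. -/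
def coveringIntervals (𝒮 : Set (ℕ × ℕ)) (p : ℕ × ℕ) (x : ℝ) : Set (ℕ × ℕ) :=
  {q | q ∈ 𝒮 ∧ dyadicI q.1 q.2 ⊆ dyadicI p.1 p.2 ∧ x ∈ dyadicI q.1 q.2}

/-- The points of the interval `p` covered by at least `j + 1` intervals of `𝒮` inside `p`. -/
def overlapSet (𝒮 : Set (ℕ × ℕ)) (p : ℕ × ℕ) (j : ℕ) : Set ℝ :=
  {x | x ∈ dyadicI p.1 p.2 ∧ (j + 1 : ℕ∞) ≤ (coveringIntervals 𝒮 p x).encard}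

theorem overlapSet_succ_subset (𝒮 : Set (ℕ × ℕ)) (p : ℕ × ℕ) (j : ℕ) :
    overlapSet 𝒮 p (j + 1) ⊆
      ⋃ q : {q : ℕ × ℕ // q ∈ 𝒮 ∧ dyadicI q.1 q.2 ⊂ dyadicI p.1 p.2}, overlapSet 𝒮 q j := by
  rintro x ⟨-, hx⟩
  have hcard : (j + 1 : ℕ∞) ≤ (coveringIntervals 𝒮 p x \ {p}).encard := by
    have h := hx.trans ((Set.encard_le_encard <| Set.subset_insert_sdiff_singleton p _).trans
      (Set.encard_insert_le (coveringIntervals 𝒮 p x \ {p}) p))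
    push_cast at h
    exact (ENat.add_le_add_iff_right ENat.one_ne_top).mp h
  have hne : (coveringIntervals 𝒮 p x \ {p}).Nonempty := by
    rw [← Set.encard_pos]
    exact lt_of_lt_of_le (by positivity) hcard
  obtain ⟨q, ⟨⟨hqS, hqp, hxq⟩, hne_p⟩, hmin⟩ :=
    (measure (Prod.fst : ℕ × ℕ → ℕ)).wf.has_min _ hne
  have hqss : dyadicI q.1 q.2 ⊂ dyadicI p.1 p.2 :=
    hqp.ssubset_of_ne fun h => hne_p (dyadicI_injective h)
  refine Set.mem_iUnion.mpr ⟨⟨q, hqS, hqss⟩, hxq, hcard.trans (Set.encard_le_encard ?_)⟩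
  intro r hr
  exact ⟨hr.1.1, dyadicI_subset_of_mem (not_lt.mp (hmin r hr)) hxq hr.1.2.2, hr.1.2.2⟩

theorem IsSparse.tsum_ofReal_le {ε : ℝ} {𝒮 : Set (ℕ × ℕ)} (h𝒮 : IsSparse ε 𝒮) {p : ℕ × ℕ}
    (hp : p ∈ 𝒮) {c : ℝ} (hc : 0 ≤ c) :
    ∑' q : {q : ℕ × ℕ // q ∈ 𝒮 ∧ dyadicI q.1 q.2 ⊂ dyadicI p.1 p.2},
      ENNReal.ofReal (c * dyadicLen q.1.1) ≤ ENNReal.ofReal (c * (ε * dyadicLen p.1)) := by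
  rw [ENNReal.tsum_eq_iSup_sum]
  refine iSup_le fun F => ?_
  rw [← ENNReal.ofReal_sum_of_nonneg fun q _ => mul_nonneg hc (dyadicLen_nonneg _),
    ← Finset.mul_sum]
  refine ENNReal.ofReal_le_ofReal (mul_le_mul_of_nonneg_left ?_ hc)
  have h := h𝒮.2 p hp (F.map (Function.Embedding.subtype _)) fun q hq => by
    obtain ⟨r, -, rfl⟩ := Finset.mem_map.mp hq
    exact r.2
  simpa only [Finset.sum_map, Function.Embedding.subtype_apply] using h

theorem IsSparse.volume_overlapSet_le {ε : ℝ} (hε : 0 ≤ ε) {𝒮 : Set (ℕ × ℕ)}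
    (h𝒮 : IsSparse ε 𝒮) (j : ℕ) {p : ℕ × ℕ} (hp : p ∈ 𝒮) :
    volume (overlapSet 𝒮 p j) ≤ ENNReal.ofReal (ε ^ j * dyadicLen p.1) := by
  induction j generalizing p with
  | zero =>
    rw [pow_zero, one_mul, ← volume_dyadicI p.1 p.2]
    exact measure_mono fun x hx => hx.1
  | succ j ih =>
    calc volume (overlapSet 𝒮 p (j + 1))
        ≤ ∑' q : {q : ℕ × ℕ // q ∈ 𝒮 ∧ dyadicI q.1 q.2 ⊂ dyadicI p.1 p.2},
            volume (overlapSet 𝒮 q j) :=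
          (measure_mono (overlapSet_succ_subset 𝒮 p j)).trans (measure_iUnion_le _)
      _ ≤ ∑' q : {q : ℕ × ℕ // q ∈ 𝒮 ∧ dyadicI q.1 q.2 ⊂ dyadicI p.1 p.2},
            ENNReal.ofReal (ε ^ j * dyadicLen q.1.1) :=
          ENNReal.tsum_le_tsum fun q => ih q.2.1
      _ ≤ ENNReal.ofReal (ε ^ j * (ε * dyadicLen p.1)) := h𝒮.tsum_ofReal_le hp (by positivity)
      _ = ENNReal.ofReal (ε ^ (j + 1) * dyadicLen p.1) := by rw [pow_succ, mul_assoc]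

/-- if `𝒮` is `ε`-sparse (`ε ∈ (0,1)`) and `Q* = (n,k) ∈ 𝒮`, then for every
`j ≥ 0` the Lebesgue measure of the set of points of `Q*` covered by at least `j+1` intervals
`ℓ ∈ 𝒮` with `ℓ ⊆ Q*` is at most `ε^j |Q*|`. -/
theorem sparse_overlap_decay (ε : ℝ) (hε0 : 0 < ε) (hε1 : ε < 1)
    (𝒮 : Set (ℕ × ℕ)) (h𝒮 : IsSparse ε 𝒮) (n k : ℕ) (hmem : (n, k) ∈ 𝒮) (j : ℕ) :
    volume {x : ℝ | x ∈ dyadicI n k ∧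
        (j + 1 : ℕ∞) ≤
          {q : ℕ × ℕ | q ∈ 𝒮 ∧ dyadicI q.1 q.2 ⊆ dyadicI n k ∧
            x ∈ dyadicI q.1 q.2}.encard}
      ≤ ENNReal.ofReal (ε ^ j * dyadicLen n) := by
  exact h𝒮.volume_overlapSet_le hε0.le j hmem
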